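/- Let X be a nontrivial finite group with k := k(X) conjugacy classes. Let t ≥ 1, m ≥ 5, 1 ≤ ℓ < m/2, and let Ω be the set of ℓ-element subsets of {1,…,m}. Let H be a large base primitive permutation group of degree n = C(m,ℓ)^t, i.e., (Alt(m))^t ≤ H ≤ Sym(m) ≀ Sym(t) where Sym(m) acts on Ω and the wreath product acts on Ω^t via the product action. Let G = X ≀ H. Then k(G) < 5^{mt} · ( 2^t · n((Sym(m))^t, S^{Ω^t}) + k^{2n/3} ), where n((Sym(m))^t, S^{Ω^t}) is the number of orbits of (Sym(m))^t acting coordinatewise on the set of functions Ω^t → S, and S is any finite set with |S| = k. -/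

import Mathlib

open Equiv MulAction

/-- The number of conjugacy classes of a group. -/
noncomputable def kclass (G : Type*) [Group G] : ℕ := Nat.card (ConjClasses G)

/-- The coordinate-permuting action of `Perm ι` on `ι → X`, as automorphisms. -/
def permAut (ι X : Type*) [Group X] : Perm ι →* MulAut (ι → X) where
  toFun e :=
    { toFun := fun f => f ∘ e.symm
      invFun := fun f => f ∘ e
      left_inv := fun f => by funext i; simp
      right_inv := fun f => by funext i; simp
      map_mul' := fun f g => rfl }
  map_one' := by ext f; rfl
  map_mul' := fun e₁ e₂ => by ext f; rfl

/-- The wreath product `X ≀ H` of a group `X` with a permutation group `H ≤ Perm ι`,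
i.e. the semidirect product `X^ι ⋊ H` where `H` permutes the direct factors of `X^ι`. -/
abbrev Wreath (X : Type*) [Group X] {ι : Type*} (H : Subgroup (Perm ι)) :=
  SemidirectProduct (ι → X) H ((permAut ι X).comp H.subtype)

/-- A group acting on `Ω` acts on the functions `Ω → S` by permuting coordinates. -/
instance funMulAction (G Ω S : Type*) [Group G] [MulAction G Ω] : MulAction G (Ω → S) where
  smul g f := fun ω => f (g⁻¹ • ω)
  one_smul f := funext fun ω => by
    show f ((1 : G)⁻¹ • ω) = f ω
    rw [inv_one, one_smul]
  mul_smul g h f := funext fun ω => by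
    show f ((g * h)⁻¹ • ω) = f (h⁻¹ • g⁻¹ • ω)
    rw [mul_inv_rev, mul_smul]

/-- `σ(h)`: the number of cycles of a permutation `h` in its disjoint cycle decomposition,
with fixed points counted as cycles of length 1; equivalently, the number of orbits of
the cyclic group generated by `h`. -/
noncomputable def cycleCount {ι : Type*} (h : Perm ι) : ℕ :=
  Nat.card (orbitRel.Quotient (Subgroup.zpowers h) ι)

/-- `n(G, α)`: the number of orbits of a group action. -/
noncomputable def orbitCount (G : Type*) [Group G] (α : Type*) [MulAction G α] : ℕ :=
  Nat.card (orbitRel.Quotient G α)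

/-- The natural action of `Perm (Fin m)` on the set of `ℓ`-element subsets of `{1, …, m}`. -/
instance subsetsMulAction (m ℓ : ℕ) :
    MulAction (Perm (Fin m)) {s : Finset (Fin m) // s.card = ℓ} where
  smul g s := ⟨s.1.image g, by rw [Finset.card_image_of_injective _ g.injective, s.2]⟩
  one_smul s := Subtype.ext (by
    show Finset.image ⇑(1 : Perm (Fin m)) s.1 = s.1
    simp)
  mul_smul g h s := Subtype.ext (by
    show Finset.image ⇑(g * h) s.1 = Finset.image ⇑g (Finset.image ⇑h s.1)
    simp [Finset.image_image, Function.comp_def])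

/-- The set of `ℓ`-element subsets of `{1, …, m}`. -/
abbrev Omega (m ℓ : ℕ) := {s : Finset (Fin m) // s.card = ℓ}

/-- The homomorphism `Sym(m) → Sym(Ω)` induced by the action on `ℓ`-subsets. -/
def subsetsHom (m ℓ : ℕ) : Perm (Fin m) →* Perm (Omega m ℓ) :=
  MulAction.toPermHom _ _

/-- The base of a wreath product in product action: `(Sym Ω)^t → Sym (Ω^t)`. -/
def baseHom (t : ℕ) (Ω : Type*) : (Fin t → Perm Ω) →* Perm (Fin t → Ω) :=
  MulAction.toPermHom _ _

/-- The top of a wreath product in product action: `Sym(t) → Sym (Ω^t)`,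
permuting coordinates. -/
def topHom (t : ℕ) (Ω : Type*) : Perm (Fin t) →* Perm (Fin t → Ω) :=
  MulAction.toPermHom _ _

/-- The subgroup `(Alt m)^t` of `Sym (Ω^t)`, where `Alt m` acts on `ℓ`-subsets. -/
def largeBaseBot (m ℓ t : ℕ) : Subgroup (Perm (Fin t → Omega m ℓ)) :=
  Subgroup.map (baseHom t (Omega m ℓ))
    (Subgroup.pi Set.univ fun _ => Subgroup.map (subsetsHom m ℓ) (alternatingGroup (Fin m)))

/-- The subgroup `Sym m ≀ Sym t` of `Sym (Ω^t)` in product action,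
where `Sym m` acts on `ℓ`-subsets. -/
def largeBaseTop (m ℓ t : ℕ) : Subgroup (Perm (Fin t → Omega m ℓ)) :=
  Subgroup.map (baseHom t (Omega m ℓ)) (Subgroup.pi Set.univ fun _ => (subsetsHom m ℓ).range)
    ⊔ (topHom t (Omega m ℓ)).range

/-! ### Part 1: counting the classes of a wreath product -/

section Part1

variable {X Λ : Type} [Group X] {H : Subgroup (Perm Λ)}

/-- The cocycle of a wreath product element. -/
def cocyc (u : Wreath X H) (i : Λ) : X := u.left (u.right.1 i)

lemma cocyc_mul (u v : Wreath X H) (i : Λ) :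
    cocyc (u * v) i = cocyc u (v.right.1 i) * cocyc v i := by
  simp [cocyc, permAut]

lemma cocyc_one (i : Λ) : cocyc (1 : Wreath X H) i = 1 := by
  simp [cocyc]

lemma cocyc_inv (u : Wreath X H) (i : Λ) :
    cocyc u⁻¹ (u.right.1 i) = (cocyc u i)⁻¹ := by
  have h := cocyc_mul u⁻¹ u i
  rw [inv_mul_cancel, cocyc_one] at h
  exact eq_inv_of_mul_eq_one_left h.symm

lemma cocyc_ext {u v : Wreath X H} (hr : u.right = v.right) (h : ∀ i, cocyc u i = cocyc v i) :
    u = v := by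
  refine SemidirectProduct.ext ?_ hr
  funext i
  have := h (u.right.1⁻¹ i)
  simpa [cocyc, ← hr] using this

lemma right_pow (u : Wreath X H) (j : ℕ) : (u ^ j).right.1 = u.right.1 ^ j := by
  have : (u ^ j).right = u.right ^ j := map_pow SemidirectProduct.rightHom u j
  rw [this]; rfl

/-- The class function attached to an element of a wreath product. -/
noncomputable def clsFun (u : Wreath X H) (i : Λ) : ConjClasses X :=
  ConjClasses.mk (cocyc (u ^ Function.minimalPeriod u.right.1 i) i)

lemma perm_iterate (h : Perm Λ) (j : ℕ) (i : Λ) : (h ^ j) i = h^[j] i := by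
  rw [Equiv.Perm.iterate_eq_pow]

lemma minPer_conj (y h : Perm Λ) (i : Λ) :
    Function.minimalPeriod (y * h * y⁻¹ : Perm Λ) (y i) = Function.minimalPeriod h i := by
  apply Function.minimalPeriod_eq_minimalPeriod_iff.2
  intro n
  simp only [Function.IsPeriodicPt, Function.IsFixedPt, ← perm_iterate, conj_pow]
  simp

lemma pow_minPer (h : Perm Λ) (i : Λ) : (h ^ Function.minimalPeriod h i) i = i := by
  rw [perm_iterate]; exact Function.isPeriodicPt_minimalPeriod _ _

lemma clsFun_conj (g u : Wreath X H) (i : Λ) :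
    clsFun (g * u * g⁻¹) (g.right.1 i) = clsFun u i := by
  unfold clsFun
  have h1 : (g * u * g⁻¹).right.1 = g.right.1 * u.right.1 * g.right.1⁻¹ := by simp
  rw [h1, minPer_conj, conj_pow, ConjClasses.mk_eq_mk_iff_isConj]
  set r := Function.minimalPeriod u.right.1 i with hr
  rw [cocyc_mul, cocyc_mul, cocyc_inv]
  have h2 : (g⁻¹).right.1 (g.right.1 i) = i := by simp
  have h3 : (u ^ r).right.1 i = i := by rw [right_pow, hr, pow_minPer]
  rw [h2, h3]
  exact (isConj_iff.2 ⟨cocyc g i, rfl⟩).symm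

lemma clsFun_inv (u : Wreath X H) (i : Λ) : clsFun u (u.right.1 i) = clsFun u i := by
  have := clsFun_conj u u i
  simpa using this

lemma beta_per [Finite Λ] (u v : Wreath X H) (h : u.right = v.right) (i : Λ) (x : X)
    (hx : x * cocyc (u ^ Function.minimalPeriod u.right.1 i) i * x⁻¹ =
      cocyc (v ^ Function.minimalPeriod u.right.1 i) i) (j k : ℕ)
    (hjk : (u.right.1 ^ j) i = (u.right.1 ^ k) i) :
    cocyc (v ^ j) i * x * (cocyc (u ^ j) i)⁻¹ = cocyc (v ^ k) i * x * (cocyc (u ^ k) i)⁻¹ := by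
  set r := Function.minimalPeriod u.right.1 i with hr
  have step : ∀ j, cocyc (v ^ (j + r)) i * x * (cocyc (u ^ (j + r)) i)⁻¹ =
      cocyc (v ^ j) i * x * (cocyc (u ^ j) i)⁻¹ := by
    intro j
    rw [pow_add, pow_add, cocyc_mul, cocyc_mul, right_pow, right_pow, ← h, hr, pow_minPer, ← hr,
      ← hx]
    group
  have step2 : ∀ q j, cocyc (v ^ (j + r * q)) i * x * (cocyc (u ^ (j + r * q)) i)⁻¹ =
      cocyc (v ^ j) i * x * (cocyc (u ^ j) i)⁻¹ := by
    intro q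
    induction q with
    | zero => intro j; simp
    | succ q ih => intro j; rw [Nat.mul_succ, ← add_assoc, step, ih]
  have key : j % r = k % r := by
    rw [perm_iterate, perm_iterate] at hjk
    have hp : 0 < r := Function.minimalPeriod_pos_of_mem_periodicPts
      (Function.Injective.mem_periodicPts u.right.1.injective i)
    rw [← Function.iterate_mod_minimalPeriod_eq,
      ← Function.iterate_mod_minimalPeriod_eq (n := k)] at hjk
    exact Function.iterate_injOn_Iio_minimalPeriod (Nat.mod_lt _ hp) (Nat.mod_lt _ hp) hjk
  rw [← Nat.mod_add_div j r, ← Nat.mod_add_div k r, step2, step2, key]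

lemma isConj_of_clsFun [Finite Λ] (u v : Wreath X H) (h : u.right = v.right)
    (hc : ∀ i, clsFun u i = clsFun v i) : IsConj u v := by
  classical
  have hx : ∀ i, ∃ x : X, x * cocyc (u ^ Function.minimalPeriod u.right.1 i) i * x⁻¹ =
      cocyc (v ^ Function.minimalPeriod u.right.1 i) i := by
    intro i
    have := hc i
    unfold clsFun at this
    rw [ConjClasses.mk_eq_mk_iff_isConj, ← h] at this
    exact isConj_iff.1 this
  choose x hx using hx
  let st : Setoid Λ := Equiv.Perm.SameCycle.setoid u.right.1
  let rep : Λ → Λ := fun i => (Quotient.mk st i).out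
  have hrep : ∀ i, Equiv.Perm.SameCycle u.right.1 (rep i) i := fun i => Quotient.mk_out (s := st) i
  have hj : ∀ i, ∃ j : ℕ, (u.right.1 ^ j) (rep i) = i := by
    intro i
    obtain ⟨j, _, h⟩ := (hrep i).exists_pow_eq'
    exact ⟨j, h⟩
  choose j hj using hj
  let b : Λ → X := fun i =>
    cocyc (v ^ j i) (rep i) * x (rep i) * (cocyc (u ^ j i) (rep i))⁻¹
  have hb : ∀ i, b (u.right.1 i) = cocyc v i * b i * (cocyc u i)⁻¹ := by
    intro i
    have e : rep (u.right.1 i) = rep i := by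
      show (Quotient.mk st _).out = (Quotient.mk st _).out
      congr 1
      exact Quotient.sound (s := st) (Equiv.Perm.SameCycle.symm ⟨1, by simp⟩)
    have h1 : b (u.right.1 i) = cocyc (v ^ (j i + 1)) (rep i) * x (rep i) *
        (cocyc (u ^ (j i + 1)) (rep i))⁻¹ := by
      show cocyc (v ^ j (u.right.1 i)) (rep (u.right.1 i)) * x (rep (u.right.1 i)) *
        (cocyc (u ^ j (u.right.1 i)) (rep (u.right.1 i)))⁻¹ = _
      have h2 := hj (u.right.1 i)
      rw [e] at h2
      rw [e]
      apply beta_per u v h _ _ (hx (rep i))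
      rw [h2, pow_succ', Equiv.Perm.mul_apply, hj]
    rw [h1, pow_succ', pow_succ', cocyc_mul, cocyc_mul, right_pow, right_pow, ← h, hj]
    show _ = cocyc v i * (cocyc (v ^ j i) (rep i) * x (rep i) * (cocyc (u ^ j i) (rep i))⁻¹) * _
    group
  rw [isConj_iff]
  refine ⟨⟨b, 1⟩, ?_⟩
  rw [mul_inv_eq_iff_eq_mul]
  apply cocyc_ext
  · simp [h]
  · intro i
    rw [cocyc_mul, cocyc_mul]
    have h1 : cocyc (⟨b, 1⟩ : Wreath X H) (u.right.1 i) = b (u.right.1 i) := by simp [cocyc]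
    have h2 : cocyc (⟨b, 1⟩ : Wreath X H) i = b i := by simp [cocyc]
    rw [h1, h2, hb]
    simp

/-- Pairs of an element of `H` and an invariant class function. -/
def ZSet (X : Type) [Group X] {Λ : Type} (H : Subgroup (Perm Λ)) :=
  {p : H × (Λ → ConjClasses X) // ∀ i, p.2 (p.1.1 i) = p.2 i}

instance (X : Type) [Group X] {Λ : Type} (H : Subgroup (Perm Λ)) : MulAction H (ZSet X H) where
  smul y z := ⟨(y * z.1.1 * y⁻¹, fun i => z.1.2 (y.1⁻¹ i)), fun i => by
    have := z.2 (y.1⁻¹ i)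
    simpa using this⟩
  one_smul z := Subtype.ext (Prod.ext (by
    show 1 * z.1.1 * 1⁻¹ = z.1.1
    simp) rfl)
  mul_smul y y' z := Subtype.ext (Prod.ext (by
    show (y * y') * z.1.1 * (y * y')⁻¹ = y * (y' * z.1.1 * y'⁻¹) * y⁻¹
    group) (by
    funext i
    show z.1.2 ((y * y').1⁻¹ i) = z.1.2 (y'.1⁻¹ (y.1⁻¹ i))
    simp))

lemma zsmul_fst (y : H) (z : ZSet X H) : (y • z).1.1 = y * z.1.1 * y⁻¹ := rfl
lemma zsmul_snd (y : H) (z : ZSet X H) (i : Λ) : (y • z).1.2 i = z.1.2 (y.1⁻¹ i) := rfl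

/-- The invariant of an element of a wreath product. -/
noncomputable def toZSet (u : Wreath X H) : ZSet X H := ⟨(u.right, clsFun u), clsFun_inv u⟩

lemma toZSet_conj (g u : Wreath X H) : toZSet (g * u * g⁻¹) = g.right • toZSet u := by
  apply Subtype.ext
  apply Prod.ext
  · rw [zsmul_fst]; simp [toZSet]
  · funext i
    rw [zsmul_snd]
    have := clsFun_conj g u (g.right.1⁻¹ i)
    simpa [toZSet] using this

lemma isConj_of_toZSet [Finite Λ] (u v : Wreath X H) (h : toZSet u = toZSet v) : IsConj u v := by
  have h' : (u.right, clsFun u) = (v.right, clsFun v) := congrArg Subtype.val h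
  rw [Prod.mk.injEq] at h'
  exact isConj_of_clsFun u v h'.1 (fun i => congrFun h'.2 i)

/-- The set of triples counted by the class number of a wreath product. -/
def Triples (H : Subgroup (Perm Λ)) (C : Type) :=
  {p : (H × H) × (Λ → C) // p.1.1 * p.1.2 = p.1.2 * p.1.1 ∧ (∀ i, p.2 (p.1.1.1 i) = p.2 i) ∧
    (∀ i, p.2 (p.1.2.1 i) = p.2 i)}

lemma kclass_wreath_le [Finite X] [Finite Λ] (H : Subgroup (Perm Λ)) :
    kclass (Wreath X H) * Nat.card H ≤ Nat.card (Triples H (ConjClasses X)) := by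
  have : Finite (ZSet X H) := by unfold ZSet; infer_instance
  have h1 : kclass (Wreath X H) ≤ Nat.card (Quotient (orbitRel H (ZSet X H))) := by
    unfold kclass
    let F : ConjClasses (Wreath X H) → Quotient (orbitRel H (ZSet X H)) :=
      Quotient.lift (fun u => Quotient.mk _ (toZSet u)) (by
        intro u v huv
        obtain ⟨g, rfl⟩ := isConj_iff.1 huv
        apply Quotient.sound
        apply (orbitRel H (ZSet X H)).symm
        rw [toZSet_conj]
        exact ⟨g.right, rfl⟩)
    apply Nat.card_le_card_of_injective F
    intro a b
    induction a using Quotient.inductionOn with | _ u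
    induction b using Quotient.inductionOn with | _ v
    intro hab
    have hab' : Quotient.mk (orbitRel H (ZSet X H)) (toZSet u) = Quotient.mk _ (toZSet v) := hab
    obtain ⟨y, hy⟩ := Quotient.exact hab'
    have hy' : y • toZSet v = toZSet u := hy
    apply Quotient.sound
    let g : Wreath X H := ⟨1, y⟩
    have : toZSet (g * v * g⁻¹) = toZSet u := by rw [toZSet_conj]; exact hy'
    have h2 : IsConj (g * v * g⁻¹) u := isConj_of_toZSet _ _ this
    have h3 : IsConj v u := (isConj_iff.2 ⟨g, rfl⟩).trans h2
    exact h3.symm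
  have h2 : Nat.card (Quotient (orbitRel H (ZSet X H))) * Nat.card H =
      Nat.card (Σ a : H, fixedBy (ZSet X H) a) := by
    rw [Nat.card_congr (MulAction.sigmaFixedByEquivOrbitsProdGroup H (ZSet X H)), Nat.card_prod]
  refine (Nat.mul_le_mul_right _ h1).trans (h2.le.trans ?_)
  have : Finite (Triples H (ConjClasses X)) := by unfold Triples; infer_instance
  let F : (Σ a : H, fixedBy (ZSet X H) a) → Triples H (ConjClasses X) := fun a =>
    ⟨((a.1, a.2.1.1.1), a.2.1.1.2), by
      obtain ⟨y, z, hz⟩ := a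
      have hz' : y • z = z := hz
      refine ⟨?_, ?_, z.2⟩
      · have := congrArg (fun z => z.1.1) hz'
        simp only [zsmul_fst] at this
        exact mul_inv_eq_iff_eq_mul.1 this
      · intro i
        have := congrArg (fun z => z.1.2 (y.1 i)) hz'
        simp only [zsmul_snd] at this
        simpa using this.symm⟩
  apply Nat.card_le_card_of_injective F
  rintro ⟨y, z, hz⟩ ⟨y', z', hz'⟩ h
  have h' := congrArg Subtype.val h
  simp only [F, Prod.mk.injEq] at h'
  obtain ⟨⟨rfl, h1⟩, h2⟩ := h'
  have : z = z' := Subtype.ext (Prod.ext h1 h2)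
  subst this
  rfl

end Part1

/-! ### Part 2: invariant functions and commuting pairs -/

section Part2

lemma inv_count {Λ S : Type} [Finite Λ] [Finite S] (x y : Perm Λ) :
    ∃ o : ℕ, Nat.card {f : Λ → S // (∀ i, f (x i) = f i) ∧ ∀ i, f (y i) = f i} = Nat.card S ^ o ∧
      2 * o ≤ Nat.card Λ + Nat.card {i : Λ // x i = i ∧ y i = i} := by
  classical
  have := Fintype.ofFinite Λ
  let K := Subgroup.closure ({x, y} : Set (Perm Λ))
  have hxK : x ∈ K := Subgroup.subset_closure (by simp)
  have hyK : y ∈ K := Subgroup.subset_closure (by simp)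
  let Q := orbitRel.Quotient K Λ
  have : Fintype Q := Fintype.ofFinite Q
  refine ⟨Nat.card Q, ?_, ?_⟩
  · have e : {f : Λ → S // (∀ i, f (x i) = f i) ∧ ∀ i, f (y i) = f i} ≃ (Q → S) :=
      { toFun := fun f => Quotient.lift f.1 (by
          rintro a b ⟨⟨k, hk⟩, hkb⟩
          have hkb' : k b = a := hkb
          rw [← hkb']
          clear hkb hkb'
          induction hk using Subgroup.closure_induction generalizing b with
          | mem z hz =>
            rcases hz with rfl | rfl
            · exact f.2.1 b
            · exact f.2.2 b
          | one => rfl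
          | mul z w _ _ h1 h2 => rw [Perm.mul_apply, h1, h2]
          | inv z _ h1 => rw [← h1 (z⁻¹ b)]; simp)
        invFun := fun g => ⟨fun i => g (Quotient.mk _ i), by
          constructor
          · intro i
            refine congrArg g (Quotient.sound ⟨⟨x, hxK⟩, rfl⟩)
          · intro i
            refine congrArg g (Quotient.sound ⟨⟨y, hyK⟩, rfl⟩)⟩
        left_inv := fun f => rfl
        right_inv := fun g => by
          funext q
          induction q using Quotient.inductionOn
          rfl }
    rw [Nat.card_congr e, Nat.card_fun]
  · have h1 : Nat.card Λ = ∑ q : Q, Nat.card (orbitRel.Quotient.orbit q) := by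
      rw [Nat.card_congr (selfEquivSigmaOrbits' K Λ), Nat.card_sigma]
    have h2 : Nat.card {i : Λ // x i = i ∧ y i = i} =
        ∑ q : Q, Nat.card {i : {i : Λ // x i = i ∧ y i = i} // (Quotient.mk _ i.1 : Q) = q} := by
      rw [← Nat.card_sigma]
      exact Nat.card_congr (Equiv.sigmaFiberEquiv _).symm
    rw [h1, h2, ← Finset.sum_add_distrib, Nat.card_eq_fintype_card, ← Finset.card_univ, mul_comm,
      ← smul_eq_mul, ← Finset.sum_const]
    apply Finset.sum_le_sum
    intro q _
    induction q using Quotient.inductionOn with | _ i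
    have hmem : ∀ k ∈ K, k i ∈ orbitRel.Quotient.orbit (Quotient.mk (orbitRel K Λ) i : Q) := by
      intro k hk
      rw [orbitRel.Quotient.mem_orbit]
      exact Quotient.sound ⟨⟨k, hk⟩, rfl⟩
    by_cases hi : x i = i ∧ y i = i
    · have a1 : 0 < Nat.card (orbitRel.Quotient.orbit (Quotient.mk (orbitRel K Λ) i : Q)) := by
        have : Nonempty (orbitRel.Quotient.orbit (Quotient.mk (orbitRel K Λ) i : Q)) :=
          ⟨⟨i, hmem 1 K.one_mem⟩⟩
        exact Nat.card_pos
      have a2 : 0 < Nat.card {j : {i : Λ // x i = i ∧ y i = i} //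
          (Quotient.mk _ j.1 : Q) = Quotient.mk _ i} := by
        have : Nonempty {j : {i : Λ // x i = i ∧ y i = i} //
          (Quotient.mk _ j.1 : Q) = Quotient.mk _ i} := ⟨⟨⟨i, hi⟩, rfl⟩⟩
        exact Nat.card_pos
      omega
    · have a1 : 1 < Nat.card (orbitRel.Quotient.orbit (Quotient.mk (orbitRel K Λ) i : Q)) := by
        rw [Finite.one_lt_card_iff_nontrivial]
        rw [not_and_or] at hi
        rcases hi with hi | hi
        · exact ⟨⟨i, hmem 1 K.one_mem⟩, ⟨x i, hmem x hxK⟩, fun h => hi (congrArg Subtype.val h).symm⟩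
        · exact ⟨⟨i, hmem 1 K.one_mem⟩, ⟨y i, hmem y hyK⟩, fun h => hi (congrArg Subtype.val h).symm⟩
      omega

/-- The number of commuting pairs. -/
noncomputable def commCount (G : Type*) [Group G] : ℕ :=
  Nat.card {p : G × G // p.1 * p.2 = p.2 * p.1}

lemma commCount_perm (α : Type*) [Fintype α] [DecidableEq α] :
    commCount (Perm α) ≤ (Fintype.card α).factorial * 2 ^ Fintype.card α := by
  have h1 : commCount (Perm α) = Nat.card (ConjClasses (Perm α)) * Nat.card (Perm α) := by
    rw [← card_comm_eq_card_conjClasses_mul_card]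
    rfl
  have h2 : Nat.card (ConjClasses (Perm α)) ≤ 2 ^ Fintype.card α := by
    let F : ConjClasses (Perm α) → (Fintype.card α).Partition :=
      Quotient.lift (fun σ => σ.partition) (fun a b h => Equiv.Perm.partition_eq_of_isConj.1 h)
    have hF : Function.Injective F := by
      intro a b
      induction a using Quotient.inductionOn with | _ u
      induction b using Quotient.inductionOn with | _ v
      intro h
      exact Quotient.sound (Equiv.Perm.partition_eq_of_isConj.2 h)
    refine (Nat.card_le_card_of_injective F hF).trans ?_
    rw [Nat.card_eq_fintype_card]
    refine (Fintype.card_le_of_surjective _ (Nat.Partition.ofComposition_surj)).trans ?_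
    rw [composition_card]
    exact Nat.pow_le_pow_right (by norm_num) (Nat.sub_le _ _)
  rw [h1, Nat.card_eq_fintype_card (α := Perm α), Fintype.card_perm, mul_comm]
  exact Nat.mul_le_mul_left _ h2

end Part2

/-! ### Part 3: moved points -/

section Part3

lemma subs_smul_val {m ℓ : ℕ} (a : Perm (Fin m)) (w : Omega m ℓ) :
    (a • w).1 = w.1.image a := rfl

lemma card_Omega (m ℓ : ℕ) : Fintype.card (Omega m ℓ) = m.choose ℓ := by
  rw [Fintype.card_finset_len, Fintype.card_fin]

/-- Points moved by `a` or `b`. -/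
def suppF {m : ℕ} (a b : Perm (Fin m)) : Finset (Fin m) :=
  Finset.univ.filter fun i => a i ≠ i ∨ b i ≠ i

/-- Subsets moved by `a` or `b`. -/
def movedF {m : ℕ} (ℓ : ℕ) (a b : Perm (Fin m)) : Finset (Omega m ℓ) :=
  Finset.univ.filter fun w => a • w ≠ w ∨ b • w ≠ w

lemma moved_of_mem {m ℓ : ℕ} (a : Perm (Fin m)) (p : Fin m) (w : Omega m ℓ) (h1 : p ∈ w.1)
    (h2 : a p ∉ w.1) : a • w ≠ w := by
  intro h
  apply h2
  rw [← h, subs_smul_val]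
  exact Finset.mem_image_of_mem _ h1

lemma card_sep {m ℓ : ℕ} (hℓ : 1 ≤ ℓ) (p q : Fin m) (hpq : q ≠ p) :
    (m - 2).choose (ℓ - 1) ≤
      (Finset.univ.filter fun w : Omega m ℓ => p ∈ w.1 ∧ q ∉ w.1).card := by
  have hc : ((Finset.univ : Finset (Fin m)) \ {p, q}).card = m - 2 := by
    rw [Finset.card_sdiff_of_subset (Finset.subset_univ _), Finset.card_univ, Fintype.card_fin,
      Finset.card_pair hpq.symm]
  rw [← hc, ← Finset.card_powersetCard]
  rw [← Finset.card_map (Function.Embedding.subtype _)]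
  apply Finset.card_le_card_of_injOn (fun s => insert p s)
  · intro s hs
    rw [Finset.mem_coe, Finset.mem_powersetCard] at hs
    have hp : p ∉ s := fun h => by simpa using hs.1 h
    have hq : q ∉ s := fun h => by simpa using hs.1 h
    simp only [Finset.coe_map, Set.mem_image, Finset.mem_coe, Finset.mem_filter]
    refine ⟨⟨insert p s, ?_⟩, ⟨Finset.mem_univ _, ?_, ?_⟩, rfl⟩
    · rw [Finset.card_insert_of_notMem hp, hs.2]; omega
    · simp
    · simp [hpq, hq]
  · intro s hs s' hs' h
    rw [Finset.mem_coe, Finset.mem_powersetCard] at hs hs'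
    have hp : p ∉ s := fun h => by simpa using hs.1 h
    have hp' : p ∉ s' := fun h => by simpa using hs'.1 h
    have h' : insert p s = insert p s' := h
    rw [← Finset.erase_insert hp, h', Finset.erase_insert hp']

lemma moved_lower {m ℓ : ℕ} (hℓ : 1 ≤ ℓ) (a b : Perm (Fin m)) :
    (suppF a b).card * (m - 2).choose (ℓ - 1) ≤ (movedF ℓ a b).card * ℓ := by
  classical
  apply Finset.card_mul_le_card_mul (fun p (w : Omega m ℓ) => p ∈ w.1)
  · intro p hp
    rw [suppF, Finset.mem_filter] at hp
    rcases hp.2 with h | h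
    · refine (card_sep hℓ p _ h).trans (Finset.card_le_card ?_)
      intro w hw
      rw [Finset.mem_filter] at hw
      rw [Finset.mem_bipartiteAbove, movedF, Finset.mem_filter]
      exact ⟨⟨Finset.mem_univ _, Or.inl (moved_of_mem a p w hw.2.1 hw.2.2)⟩, hw.2.1⟩
    · refine (card_sep hℓ p _ h).trans (Finset.card_le_card ?_)
      intro w hw
      rw [Finset.mem_filter] at hw
      rw [Finset.mem_bipartiteAbove, movedF, Finset.mem_filter]
      exact ⟨⟨Finset.mem_univ _, Or.inr (moved_of_mem b p w hw.2.1 hw.2.2)⟩, hw.2.1⟩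
  · intro w _
    refine (Finset.card_le_card (t := w.1) ?_).trans w.2.le
    intro p hp
    exact ((Finset.mem_bipartiteBelow _).1 hp).2

lemma choose_mono_half {M : ℕ} (r : ℕ) (k : ℕ) (h : 2 * (r + k) ≤ M) :
    M.choose r ≤ M.choose (r + k) := by
  induction k with
  | zero => rfl
  | succ k ih =>
    refine (ih (by omega)).trans ?_
    exact Nat.choose_le_succ_of_lt_half_left (by omega)

lemma choose_lower {m ℓ : ℕ} (hℓ : 2 ≤ ℓ) (hm : 2 * ℓ < m) :
    ℓ * (m - 2) ≤ 2 * (m - 2).choose (ℓ - 1) := by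
  obtain ⟨M, rfl⟩ : ∃ M, m = M + 2 := ⟨m - 2, by omega⟩
  obtain ⟨L, rfl⟩ : ∃ L, ℓ = L + 2 := ⟨ℓ - 2, by omega⟩
  have h1 := Nat.add_one_mul_choose_eq M (L + 1)
  have h2 : (M + 1).choose 2 ≤ (M + 1).choose (2 + L) := choose_mono_half 2 L (by omega)
  have h3 := Nat.add_one_mul_choose_eq M 1
  rw [Nat.choose_one_right] at h3
  rw [show 2 + L = L + 1 + 1 by ring] at h2
  simp only [Nat.add_sub_cancel, show L + 2 - 1 = L + 1 by omega]
  have h4 : (M + 1) * ((L + 2) * M) ≤ (M + 1) * (2 * M.choose (L + 1)) := by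
    calc (M + 1) * ((L + 2) * M) = (L + 2) * ((M + 1) * M) := by ring
      _ = (L + 2) * ((M + 1).choose (1 + 1) * (1 + 1)) := by rw [h3]
      _ ≤ (L + 2) * ((M + 1).choose (L + 1 + 1) * (1 + 1)) := by gcongr
      _ = 2 * ((M + 1).choose (L + 1 + 1) * (L + 1 + 1)) := by ring
      _ = 2 * ((M + 1) * M.choose (L + 1)) := by rw [h1]
      _ = _ := by ring
  exact Nat.le_of_mul_le_mul_left h4 (by omega)

lemma le_choose_self {m ℓ : ℕ} (hℓ : 1 ≤ ℓ) (hm : 2 * ℓ < m) : m ≤ m.choose ℓ := by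
  have := choose_mono_half (M := m) 1 (ℓ - 1) (by omega)
  rwa [Nat.choose_one_right, show 1 + (ℓ - 1) = ℓ by omega] at this

lemma le_five_pow (t : ℕ) : t + 1 ≤ 5 ^ t :=  Nat.lt_pow_self (by norm_num)

lemma moved_coord {m ℓ t : ℕ} (ht : 1 ≤ t) (hm5 : 5 ≤ m) (hℓ : 1 ≤ ℓ) (hm : 2 * ℓ < m)
    (hne : ¬ (t = 1 ∧ ℓ = 1)) (a b : Perm (Fin m)) :
    t * ((m - 2) * (suppF a b).card) ≤ 2 * ((movedF ℓ a b).card * (m.choose ℓ) ^ (t - 1)) := by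
  have h1 := moved_lower hℓ a b
  have h2 := le_choose_self hℓ hm
  rcases Nat.lt_or_ge 1 ℓ with hl | hl
  · have h3 := choose_lower hl hm
    have h4 : (m - 2) * (suppF a b).card ≤ 2 * (movedF ℓ a b).card := by
      apply Nat.le_of_mul_le_mul_left (c := 0 + ℓ) _ (by omega)
      rw [zero_add]
      calc ℓ * ((m - 2) * (suppF a b).card) = (suppF a b).card * (ℓ * (m - 2)) := by ring
        _ ≤ (suppF a b).card * (2 * (m - 2).choose (ℓ - 1)) := by gcongr
        _ = 2 * ((suppF a b).card * (m - 2).choose (ℓ - 1)) := by ring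
        _ ≤ 2 * ((movedF ℓ a b).card * ℓ) := by gcongr
        _ = _ := by ring
    have h5 : t ≤ m.choose ℓ ^ (t - 1) := by
      calc t = t - 1 + 1 := by omega
        _ ≤ 5 ^ (t - 1) := le_five_pow _
        _ ≤ _ := Nat.pow_le_pow_left (by omega) _
    calc t * ((m - 2) * (suppF a b).card) ≤ m.choose ℓ ^ (t - 1) * (2 * (movedF ℓ a b).card) :=
          Nat.mul_le_mul h5 h4
      _ = _ := by ring
  · have hl1 : ℓ = 1 := by omega
    subst hl1
    simp only [Nat.sub_self, Nat.choose_zero_right, mul_one, Nat.choose_one_right] at h1 ⊢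
    have h5 : t * (m - 2) ≤ 2 * m ^ (t - 1) := by
      obtain ⟨T, rfl⟩ : ∃ T, t = T + 2 := ⟨t - 2, by omega⟩
      have : T + 1 ≤ m ^ T := (le_five_pow T).trans (Nat.pow_le_pow_left hm5 _)
      calc (T + 2) * (m - 2) ≤ (2 * m ^ T) * m := Nat.mul_le_mul (by omega) (by omega)
        _ = 2 * m ^ (T + 2 - 1) := by
          rw [show T + 2 - 1 = T + 1 by omega]; ring
    calc t * ((m - 2) * (suppF a b).card) = t * (m - 2) * (suppF a b).card := by ring
      _ ≤ 2 * m ^ (t - 1) * (movedF 1 a b).card := Nat.mul_le_mul h5 h1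
      _ = _ := by ring

/-- The action homomorphism of `(Sym m)^t` on `Ω^t`. -/
def prodHom (m ℓ t : ℕ) : (Fin t → Perm (Fin m)) →* Perm (Fin t → Omega m ℓ) :=
  MulAction.toPermHom _ _

lemma prodHom_apply {m ℓ t : ℕ} (a : Fin t → Perm (Fin m)) (w : Fin t → Omega m ℓ) (i : Fin t) :
    prodHom m ℓ t a w i = a i • w i := rfl

/-- Tuples moved. -/
def movedT {m t : ℕ} (ℓ : ℕ) (a b : Fin t → Perm (Fin m)) : Finset (Fin t → Omega m ℓ) :=
  Finset.univ.filter fun w => prodHom m ℓ t a w ≠ w ∨ prodHom m ℓ t b w ≠ w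

lemma card_update {t : ℕ} {α : Type} [Fintype α] [DecidableEq α] (i : Fin t) (M : Finset α) :
    (Finset.univ.filter fun w : Fin t → α => w i ∈ M).card =
      M.card * (Fintype.card α) ^ (t - 1) := by
  have : (Finset.univ.filter fun w : Fin t → α => w i ∈ M) =
      Fintype.piFinset (fun j => if j = i then M else Finset.univ) := by
    ext w
    simp only [Finset.mem_filter, Finset.mem_univ, true_and, Fintype.mem_piFinset]
    constructor
    · intro h j
      split_ifs with hj
      · rw [hj]; exact h
      · simp
    · intro h
      simpa using h i
  rw [this, Fintype.card_piFinset, ← Finset.mul_prod_erase _ _ (Finset.mem_univ i)]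
  rw [if_pos rfl]
  congr 1
  rw [Finset.prod_congr rfl (g := fun _ => Fintype.card α)]
  · rw [Finset.prod_const, Finset.card_erase_of_mem (Finset.mem_univ _), Finset.card_univ,
      Fintype.card_fin]
  · intro j hj
    rw [if_neg (Finset.ne_of_mem_erase hj), Finset.card_univ]

lemma movedT_lower {m ℓ t : ℕ} (a b : Fin t → Perm (Fin m)) (i : Fin t) :
    (movedF ℓ (a i) (b i)).card * (m.choose ℓ) ^ (t - 1) ≤ (movedT ℓ a b).card := by
  rw [← card_Omega, ← card_update]
  apply Finset.card_le_card
  intro w hw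
  simp only [movedF, movedT, Finset.mem_filter, Finset.mem_univ, true_and] at hw ⊢
  rcases hw with h | h
  · exact Or.inl fun h' => h (congrFun h' i)
  · exact Or.inr fun h' => h (congrFun h' i)

lemma movedT_main {m ℓ t : ℕ} (ht : 1 ≤ t) (hm5 : 5 ≤ m) (hℓ : 1 ≤ ℓ) (hm : 2 * ℓ < m)
    (hne : ¬ (t = 1 ∧ ℓ = 1)) (a b : Fin t → Perm (Fin m)) :
    (m - 2) * ∑ i, (suppF (a i) (b i)).card ≤ 2 * (movedT ℓ a b).card := by
  apply Nat.le_of_mul_le_mul_left (c := 0 + t) _ (by omega)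
  rw [zero_add, Finset.mul_sum, Finset.mul_sum]
  calc ∑ i, t * ((m - 2) * (suppF (a i) (b i)).card) ≤ ∑ i : Fin t, 2 * (movedT ℓ a b).card := by
        apply Finset.sum_le_sum
        intro i _
        exact (moved_coord ht hm5 hℓ hm hne _ _).trans
          (Nat.mul_le_mul_left _ (movedT_lower a b i))
    _ = _ := by simp

lemma prodHom_injective {m ℓ t : ℕ} (hm5 : 5 ≤ m) (hℓ : 1 ≤ ℓ) (hm : 2 * ℓ < m) :
    Function.Injective (prodHom m ℓ t) := by
  rw [injective_iff_map_eq_one]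
  intro a ha
  funext i
  have h0 : (movedT ℓ a a).card = 0 := by
    simp [movedT, ha]
  have h1 := movedT_lower (ℓ := ℓ) a a i
  have h2 := le_choose_self hℓ hm
  have hpos : 0 < m.choose ℓ ^ (t - 1) := by
    apply Nat.pow_pos; omega
  have h3 : (movedF ℓ (a i) (a i)).card = 0 := by
    rw [h0] at h1
    rcases Nat.mul_eq_zero.1 (Nat.le_zero.1 h1) with h | h
    · exact h
    · omega
  have h4 := moved_lower hℓ (a i) (a i)
  rw [h3, zero_mul] at h4
  have h5 : 0 < (m - 2).choose (ℓ - 1) := Nat.choose_pos (by omega)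
  have h6 : (suppF (a i) (a i)).card = 0 := by
    rcases Nat.mul_eq_zero.1 (Nat.le_zero.1 h4) with h | h
    · exact h
    · omega
  ext j
  by_contra hj
  have : j ∈ suppF (a i) (a i) := by
    simp only [suppF, Finset.mem_filter, Finset.mem_univ, true_and]
    left
    intro h
    apply hj
    rw [h]; rfl
  rw [Finset.card_eq_zero] at h6
  rw [h6] at this
  simp at this

end Part3

/-! ### Part 4: weighted sums over commuting pairs -/

section Part4

lemma card_comm_supp {m : ℕ} (D : Finset (Fin m)) :
    (Finset.univ.filter fun p : Perm (Fin m) × Perm (Fin m) =>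
      p.1 * p.2 = p.2 * p.1 ∧ suppF p.1 p.2 = D).card ≤ D.card.factorial * 2 ^ D.card := by
  have h1 := commCount_perm D
  rw [Fintype.card_coe] at h1
  refine le_trans ?_ h1
  classical
  unfold commCount
  rw [Nat.card_eq_fintype_card, Fintype.card_subtype]
  let F : Perm D × Perm D → Perm (Fin m) × Perm (Fin m) := fun p =>
    (Perm.ofSubtype (p := fun x => x ∈ D) p.1, Perm.ofSubtype (p := fun x => x ∈ D) p.2)
  refine le_trans (Finset.card_le_card ?_) (Finset.card_image_le (f := F))
  rintro ⟨a, b⟩ hab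
  simp only [Finset.mem_filter, Finset.mem_univ, true_and] at hab
  obtain ⟨hc, hD⟩ := hab
  have ha : ∀ x, a x ≠ x → x ∈ D := fun x hx => by
    rw [← hD]; simp [suppF, hx]
  have hb : ∀ x, b x ≠ x → x ∈ D := fun x hx => by
    rw [← hD]; simp [suppF, hx]
  have aux : ∀ c : Perm (Fin m), (∀ x, c x ≠ x → x ∈ D) → ∀ x, c x ∈ D ↔ x ∈ D := by
    intro c hcD x
    by_cases hx : c x = x
    · rw [hx]
    · exact ⟨fun _ => hcD x hx, fun _ => hcD _ fun h => hx (c.injective h)⟩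
  have ea := Perm.ofSubtype_subtypePerm (p := fun x => x ∈ D) (aux a ha) ha
  have eb := Perm.ofSubtype_subtypePerm (p := fun x => x ∈ D) (aux b hb) hb
  rw [Finset.mem_image]
  refine ⟨(a.subtypePerm (aux a ha), b.subtypePerm (aux b hb)), ?_, ?_⟩
  · simp only [Finset.mem_filter, Finset.mem_univ, true_and]
    apply Perm.ofSubtype_injective
    rw [map_mul, map_mul, ea, eb, hc]
  · exact Prod.ext ea eb

lemma pow_four_le (m : ℕ) (hm : 13 ≤ m) : m ^ 4 ≤ 2 ^ (m + 2) := by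
  induction m, hm using Nat.le_induction with
  | base => norm_num
  | succ k hk ih =>
    have : (k + 1) ^ 4 ≤ 2 * k ^ 4 := by
      obtain ⟨j, rfl⟩ : ∃ j, k = j + 13 := ⟨k - 13, by omega⟩
      ring_nf
      nlinarith [sq_nonneg (j : ℤ), Nat.zero_le (j ^ 3), Nat.zero_le (j ^ 2), Nat.zero_le (j ^ 4)]
    calc (k + 1) ^ 4 ≤ 2 * k ^ 4 := this
      _ ≤ 2 * 2 ^ (k + 2) := by omega
      _ = _ := by ring

lemma num_sum_small (m : ℕ) (c : ℝ) (x : ℝ) (hx0 : 0 ≤ x) (hx : x ≤ c)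
    (h : ∑ s ∈ Finset.range (m + 1), (m.choose s : ℝ) * ((s.factorial : ℝ) * c ^ s) ≤ 5 ^ m) :
    ∑ s ∈ Finset.range (m + 1), (m.choose s : ℝ) * ((s.factorial : ℝ) * x ^ s) ≤ 5 ^ m := by
  refine le_trans (Finset.sum_le_sum fun s _ => ?_) h
  gcongr

lemma num_sum_large (m : ℕ) (x : ℝ) (hx0 : 0 ≤ x) (hx : m * x ≤ 4) :
    ∑ s ∈ Finset.range (m + 1), (m.choose s : ℝ) * ((s.factorial : ℝ) * x ^ s) ≤ 5 ^ m := by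
  have h5 : (5 : ℝ) ^ m = ∑ s ∈ Finset.range (m + 1), (m.choose s : ℝ) * 4 ^ s := by
    rw [show (5 : ℝ) = 4 + 1 by norm_num, add_pow]
    apply Finset.sum_congr rfl
    intros; rw [one_pow]; ring
  rw [h5]
  apply Finset.sum_le_sum
  intro s hs
  have hs' : s ≤ m := by simpa [Nat.lt_succ_iff] using hs
  gcongr
  have h6 : (s.factorial : ℝ) ≤ (m : ℝ) ^ s := by
    have : s.factorial ≤ m ^ s := (Nat.factorial_le_pow s).trans (Nat.pow_le_pow_left hs' s)
    exact_mod_cast this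
  calc (s.factorial : ℝ) * x ^ s ≤ (m : ℝ) ^ s * x ^ s := by gcongr
    _ = (m * x) ^ s := by rw [mul_pow]
    _ ≤ 4 ^ s := by gcongr

lemma num_sum (m : ℕ) (hm : 5 ≤ m) (r : ℝ) (hr0 : 0 ≤ r) (hr : r ^ 4 = 1 / 2) :
    ∑ s ∈ Finset.range (m + 1), (m.choose s : ℝ) *
      ((s.factorial : ℝ) * (2 * r ^ (m - 2)) ^ s) ≤ 5 ^ m := by
  have hr1 : r ≤ 1 := by
    by_contra h
    push Not at h
    have : 1 < r ^ 4 := one_lt_pow₀ h (by norm_num)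
    rw [hr] at this; norm_num at this
  rcases Nat.lt_or_ge m 13 with h13 | h13
  · rcases Nat.lt_or_ge m 6 with h6 | h6
    · obtain rfl : m = 5 := by omega
      apply num_sum_small 5 (1.2) _ (by positivity)
      · have : r ^ 3 ≤ 0.6 := by
          apply le_of_pow_le_pow_left₀ (n := 4) (by norm_num) (by norm_num)
          rw [← pow_mul, show 3 * 4 = 4 * 3 by norm_num, pow_mul, hr]; norm_num
        norm_num at this ⊢; linarith
      · norm_num [Finset.sum_range_succ, Nat.choose, Nat.factorial]
    · rcases Nat.lt_or_ge m 10 with h10 | h10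
      · apply num_sum_small m 1 _ (by positivity)
        · have : r ^ (m - 2) ≤ r ^ 4 := pow_le_pow_of_le_one hr0 hr1 (by omega)
          rw [hr] at this; linarith
        · interval_cases m <;> norm_num [Finset.sum_range_succ, Nat.choose, Nat.factorial]
      · apply num_sum_small m (1 / 2) _ (by positivity)
        · have : r ^ (m - 2) ≤ r ^ (4 * 2) := pow_le_pow_of_le_one hr0 hr1 (by omega)
          rw [pow_mul, hr] at this; norm_num at this ⊢; linarith
        · interval_cases m <;> norm_num [Finset.sum_range_succ, Nat.choose, Nat.factorial]
  · apply num_sum_large m _ (by positivity)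
    have : m * r ^ (m - 2) ≤ 2 := by
      apply le_of_pow_le_pow_left₀ (n := 4) (by norm_num) (by norm_num)
      rw [mul_pow, ← pow_mul, mul_comm (m - 2) 4, pow_mul, hr]
      have h1 : (m : ℝ) ^ 4 ≤ 2 ^ (m + 2) := by exact_mod_cast pow_four_le m h13
      have h2 : (2 : ℝ) ^ (m + 2) = 2 ^ (m - 2) * 16 := by
        rw [show m + 2 = (m - 2) + 4 by omega, pow_add]; norm_num
      rw [h2] at h1
      rw [one_div, inv_pow]
      rw [← div_eq_mul_inv, div_le_iff₀ (by positivity)]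
      linarith
    linarith

lemma comm_sum (m : ℕ) (hm : 5 ≤ m) (r : ℝ) (hr0 : 0 ≤ r) (hr : r ^ 4 = 1 / 2) :
    ∑ p : Perm (Fin m) × Perm (Fin m),
      (if p.1 * p.2 = p.2 * p.1 then (r ^ (m - 2)) ^ (suppF p.1 p.2).card else 0) ≤ 5 ^ m := by
  classical
  refine le_trans ?_ (num_sum m hm r hr0 hr)
  rw [← Finset.sum_fiberwise Finset.univ
    (fun p : Perm (Fin m) × Perm (Fin m) => suppF p.1 p.2)]
  have key : ∑ s ∈ Finset.range (m + 1), (m.choose s : ℝ) *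
      ((s.factorial : ℝ) * (2 * r ^ (m - 2)) ^ s) =
      ∑ D : Finset (Fin m), ((D.card.factorial : ℝ) * (2 * r ^ (m - 2)) ^ D.card) := by
    have := Finset.sum_powerset_apply_card
      (fun s => (s.factorial : ℝ) * (2 * r ^ (m - 2)) ^ s) (x := (Finset.univ : Finset (Fin m)))
    rw [Finset.powerset_univ] at this
    rw [this]
    simp
  rw [key]
  apply Finset.sum_le_sum
  intro D _
  rw [← Finset.sum_filter, Finset.filter_filter]
  have h1 : ∑ p : Perm (Fin m) × Perm (Fin m) with
      suppF p.1 p.2 = D ∧ p.1 * p.2 = p.2 * p.1, (r ^ (m - 2)) ^ (suppF p.1 p.2).card =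
      ∑ p : Perm (Fin m) × Perm (Fin m) with
      suppF p.1 p.2 = D ∧ p.1 * p.2 = p.2 * p.1, (r ^ (m - 2)) ^ D.card := by
    apply Finset.sum_congr rfl
    intro p hp
    rw [Finset.mem_filter] at hp
    rw [hp.2.1]
  rw [h1, Finset.sum_const, nsmul_eq_mul]
  have h2 := card_comm_supp D
  simp only [and_comm (b := suppF _ _ = D)] at h2
  rw [mul_pow, ← mul_assoc]
  gcongr
  exact_mod_cast h2

lemma comm_sum_pi (m t : ℕ) (hm : 5 ≤ m) (r : ℝ) (hr0 : 0 ≤ r) (hr : r ^ 4 = 1 / 2) :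
    ∑ p : (Fin t → Perm (Fin m)) × (Fin t → Perm (Fin m)),
      (if p.1 * p.2 = p.2 * p.1 then r ^ ((m - 2) * ∑ i, (suppF (p.1 i) (p.2 i)).card) else 0) ≤
      5 ^ (m * t) := by
  classical
  have h0 := comm_sum m hm r hr0 hr
  have h1 : (∑ p : Perm (Fin m) × Perm (Fin m),
      (if p.1 * p.2 = p.2 * p.1 then (r ^ (m - 2)) ^ (suppF p.1 p.2).card else 0)) ^ t ≤
      ((5 : ℝ) ^ m) ^ t := by
    apply pow_le_pow_left₀ _ h0
    apply Finset.sum_nonneg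
    intros; split_ifs <;> positivity
  rw [← pow_mul] at h1
  refine le_trans (le_of_eq ?_) h1
  have h2 := Fintype.sum_pow (fun p : Perm (Fin m) × Perm (Fin m) =>
    (if p.1 * p.2 = p.2 * p.1 then (r ^ (m - 2)) ^ (suppF p.1 p.2).card else (0 : ℝ))) t
  rw [h2]
  refine Fintype.sum_equiv (Equiv.arrowProdEquivProdArrow (Fin t) (fun _ => Perm (Fin m))
    (fun _ => Perm (Fin m))).symm _ _ ?_
  rintro ⟨a, b⟩
  simp only [Equiv.arrowProdEquivProdArrow, Equiv.coe_fn_symm_mk]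
  by_cases hab : a * b = b * a
  · rw [if_pos hab]
    rw [Finset.prod_congr rfl (g := fun i => (r ^ (m - 2)) ^ (suppF (a i) (b i)).card)]
    · rw [Finset.prod_pow_eq_pow_sum, ← pow_mul]
    · intro i _
      exact if_pos (congrFun hab i)
  · rw [if_neg hab]
    symm
    obtain ⟨i, hi⟩ : ∃ i, ¬ (a i * b i = b i * a i) := by
      by_contra h
      push Not at h
      exact hab (funext h)
    exact Finset.prod_eq_zero (Finset.mem_univ i) (if_neg hi)

end Part4

/-! ### Part 5: the contribution of the base group -/

section Part5

lemma card_subtype_prod {A B : Type} [Fintype A] [Finite B] (R : A → B → Prop) :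
    Nat.card {p : A × B // R p.1 p.2} = ∑ a, Nat.card {b // R a b} := by
  rw [← Nat.card_sigma]
  exact Nat.card_congr
    { toFun := fun p => ⟨p.1.1, p.1.2, p.2⟩
      invFun := fun p => ⟨(p.1, p.2.1), p.2.2⟩
      left_inv := fun _ => rfl
      right_inv := fun _ => rfl }

lemma fun_smul_eq_iff {m ℓ t : ℕ} {S : Type} (a : Fin t → Perm (Fin m))
    (f : (Fin t → Omega m ℓ) → S) : a • f = f ↔ ∀ w, f (prodHom m ℓ t a w) = f w := by
  constructor
  · intro h w
    have := congrFun h (a • w)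
    have h2 : (a • f) (a • w) = f (a⁻¹ • a • w) := rfl
    rw [h2, inv_smul_smul] at this
    exact this.symm
  · intro h
    funext w
    have := h (a⁻¹ • w)
    have h2 : prodHom m ℓ t a (a⁻¹ • w) = a • a⁻¹ • w := rfl
    rw [h2, smul_inv_smul] at this
    exact this.symm

lemma burnside_count (m ℓ t : ℕ) (S : Type) [Finite S] :
    Nat.card {p : (Fin t → Perm (Fin m)) × ((Fin t → Omega m ℓ) → S) //
      ∀ w, p.2 (prodHom m ℓ t p.1 w) = p.2 w} =
    orbitCount (Fin t → Perm (Fin m)) ((Fin t → Omega m ℓ) → S) *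
      Nat.card (Fin t → Perm (Fin m)) := by
  unfold orbitCount
  have := Nat.card_congr (MulAction.sigmaFixedByEquivOrbitsProdGroup (Fin t → Perm (Fin m))
    ((Fin t → Omega m ℓ) → S))
  rw [Nat.card_prod] at this
  refine Eq.trans ?_ this
  exact Nat.card_congr
    { toFun := fun p => ⟨p.1.1, p.1.2, (fun_smul_eq_iff _ _).2 p.2⟩
      invFun := fun p => ⟨(p.1, p.2.1), (fun_smul_eq_iff _ _).1 p.2.2⟩
      left_inv := fun _ => rfl
      right_inv := fun _ => rfl }

lemma card_fun_le (m ℓ t : ℕ) (S : Type) [Finite S] :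
    Nat.card S ^ (m.choose ℓ ^ t) ≤
    orbitCount (Fin t → Perm (Fin m)) ((Fin t → Omega m ℓ) → S) *
      Nat.card (Fin t → Perm (Fin m)) := by
  rw [← burnside_count]
  have h : Nat.card ((Fin t → Omega m ℓ) → S) = Nat.card S ^ (m.choose ℓ ^ t) := by
    rw [Nat.card_fun, Nat.card_fun, Nat.card_eq_fintype_card (α := Omega m ℓ), card_Omega,
      Nat.card_eq_fintype_card (α := Fin t), Fintype.card_fin]
  rw [← h]
  apply Nat.card_le_card_of_injective (fun f => ⟨(1, f), fun w => by rw [map_one]; rfl⟩)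
  intro f g hfg
  exact congrArg (fun p => p.1.2) hfg

/-- Number of triples in the base group. -/
noncomputable def baseTriples (m ℓ t : ℕ) (S : Type) : ℕ :=
  Nat.card {p : ((Fin t → Perm (Fin m)) × (Fin t → Perm (Fin m))) × ((Fin t → Omega m ℓ) → S) //
    p.1.1 * p.1.2 = p.1.2 * p.1.1 ∧ (∀ w, p.2 (prodHom m ℓ t p.1.1 w) = p.2 w) ∧
      (∀ w, p.2 (prodHom m ℓ t p.1.2 w) = p.2 w)}

lemma inv_bound {m ℓ t : ℕ} (ht : 1 ≤ t) (hm5 : 5 ≤ m) (hℓ : 1 ≤ ℓ) (hm : 2 * ℓ < m)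
    (hne : ¬ (t = 1 ∧ ℓ = 1)) (S : Type) [Finite S] (hS : 2 ≤ Nat.card S)
    (r : ℝ) (hr0 : 0 ≤ r) (hr : r ^ 4 = 1 / 2) (a b : Fin t → Perm (Fin m)) :
    (Nat.card {f : (Fin t → Omega m ℓ) → S // (∀ w, f (prodHom m ℓ t a w) = f w) ∧
      (∀ w, f (prodHom m ℓ t b w) = f w)} : ℝ) ≤
    (Nat.card S : ℝ) ^ (m.choose ℓ ^ t) * r ^ ((m - 2) * ∑ i, (suppF (a i) (b i)).card) := by
  classical
  have hr1 : r ≤ 1 := by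
    by_contra h
    push Not at h
    have : 1 < r ^ 4 := one_lt_pow₀ h (by norm_num)
    rw [hr] at this; norm_num at this
  obtain ⟨o, ho, ho2⟩ := inv_count (S := S) (prodHom m ℓ t a) (prodHom m ℓ t b)
  rw [ho]
  have hn : Nat.card (Fin t → Omega m ℓ) = m.choose ℓ ^ t := by
    rw [Nat.card_fun, Nat.card_eq_fintype_card (α := Omega m ℓ), card_Omega,
      Nat.card_eq_fintype_card (α := Fin t), Fintype.card_fin]
  have hmv : Nat.card {w : Fin t → Omega m ℓ // prodHom m ℓ t a w = w ∧ prodHom m ℓ t b w = w} +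
      (movedT ℓ a b).card = m.choose ℓ ^ t := by
    rw [← hn, Nat.card_eq_fintype_card, Nat.card_eq_fintype_card, Fintype.card_subtype,
      ← Finset.card_univ, ← Finset.card_filter_add_card_filter_not (s := Finset.univ)
      (fun w : Fin t → Omega m ℓ => prodHom m ℓ t a w = w ∧ prodHom m ℓ t b w = w)]
    congr 2
    ext w
    simp only [movedT, Finset.mem_filter, Finset.mem_univ, true_and]
    tauto
  rw [hn] at ho2
  set n := m.choose ℓ ^ t
  have hmain := movedT_main ht hm5 hℓ hm hne a b
  obtain ⟨d, hd⟩ : ∃ d, n = o + d := ⟨n - o, by omega⟩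
  have hd4 : (m - 2) * ∑ i, (suppF (a i) (b i)).card ≤ 4 * d := by omega
  rw [hd]
  push_cast
  rw [pow_add, mul_assoc]
  apply le_mul_of_one_le_right (by positivity)
  have hS' : (2 : ℝ) ≤ Nat.card S := by exact_mod_cast hS
  calc (1 : ℝ) = 2 ^ d * r ^ (4 * d) := by
        rw [pow_mul, hr, ← mul_pow]; norm_num
    _ ≤ (Nat.card S : ℝ) ^ d * r ^ ((m - 2) * ∑ i, (suppF (a i) (b i)).card) := by
        gcongr ?_ * ?_
        · exact pow_le_pow_left₀ (by norm_num) hS' _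
        · exact pow_le_pow_of_le_one hr0 hr1 hd4

lemma baseTriples_gen {m ℓ t : ℕ} (ht : 1 ≤ t) (hm5 : 5 ≤ m) (hℓ : 1 ≤ ℓ) (hm : 2 * ℓ < m)
    (hne : ¬ (t = 1 ∧ ℓ = 1)) (S : Type) [Finite S] (hS : 2 ≤ Nat.card S) :
    (baseTriples m ℓ t S : ℝ) ≤ 5 ^ (m * t) *
      ((orbitCount (Fin t → Perm (Fin m)) ((Fin t → Omega m ℓ) → S) : ℝ) *
      (Nat.card (Fin t → Perm (Fin m)) : ℝ)) := by
  classical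
  obtain ⟨r, hr0, hr⟩ : ∃ r : ℝ, 0 ≤ r ∧ r ^ 4 = 1 / 2 :=
    ⟨√√(1 / 2), by positivity, by
      rw [show 4 = 2 * 2 by norm_num, pow_mul, Real.sq_sqrt (by positivity),
        Real.sq_sqrt (by positivity)]⟩
  have h1 := comm_sum_pi m t hm5 r hr0 hr
  have h2 := card_fun_le m ℓ t S
  unfold baseTriples
  rw [card_subtype_prod (fun (p : (Fin t → Perm (Fin m)) × (Fin t → Perm (Fin m)))
    (f : (Fin t → Omega m ℓ) → S) => p.1 * p.2 = p.2 * p.1 ∧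
    (∀ w, f (prodHom m ℓ t p.1 w) = f w) ∧ (∀ w, f (prodHom m ℓ t p.2 w) = f w))]
  push_cast
  have h3 : ∀ p : (Fin t → Perm (Fin m)) × (Fin t → Perm (Fin m)),
      (Nat.card {f : (Fin t → Omega m ℓ) → S // p.1 * p.2 = p.2 * p.1 ∧
      (∀ w, f (prodHom m ℓ t p.1 w) = f w) ∧ (∀ w, f (prodHom m ℓ t p.2 w) = f w)} : ℝ) ≤
      (Nat.card S : ℝ) ^ (m.choose ℓ ^ t) * (if p.1 * p.2 = p.2 * p.1 then
        r ^ ((m - 2) * ∑ i, (suppF (p.1 i) (p.2 i)).card) else 0) := by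
    intro p
    by_cases hp : p.1 * p.2 = p.2 * p.1
    · rw [if_pos hp]
      simp only [hp, true_and]
      exact inv_bound ht hm5 hℓ hm hne S hS r hr0 hr p.1 p.2
    · rw [if_neg hp]
      simp [hp]
  refine (Finset.sum_le_sum fun p _ => h3 p).trans ?_
  rw [← Finset.mul_sum, mul_comm]
  gcongr
  exact_mod_cast h2

lemma young_count {m : ℕ} {S : Type} [Finite S] (f : Fin m → S) :
    Nat.card {p : Perm (Fin m) × Perm (Fin m) // p.1 * p.2 = p.2 * p.1 ∧
      (∀ i, f (p.1 i) = f i) ∧ ∀ i, f (p.2 i) = f i} ≤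
    2 ^ m * Nat.card {g : Perm (Fin m) // f ∘ g = f} := by
  classical
  have := Fintype.ofFinite S
  rw [Nat.card_eq_fintype_card (α := {g : Perm (Fin m) // f ∘ g = f}), DomMulAct.stabilizer_card]
  have h1 : ∏ c : S, commCount (Perm {i // f i = c}) ≤
      2 ^ m * ∏ c : S, (Fintype.card {i // f i = c}).factorial := by
    have hsum : ∑ c : S, Fintype.card {i // f i = c} = m := by
      rw [← Fintype.card_sigma, Fintype.card_congr (Equiv.sigmaFiberEquiv f), Fintype.card_fin]
    calc ∏ c : S, commCount (Perm {i // f i = c}) ≤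
        ∏ c : S, ((Fintype.card {i // f i = c}).factorial * 2 ^ Fintype.card {i // f i = c}) :=
          Finset.prod_le_prod' fun c _ => commCount_perm _
      _ = _ := by
        rw [Finset.prod_mul_distrib, Finset.prod_pow_eq_pow_sum, hsum, mul_comm]
  refine le_trans ?_ h1
  unfold commCount
  rw [← Nat.card_pi]
  have hh : ∀ x : Perm (Fin m), (∀ i, f (x i) = f i) → ∀ c, ∀ i, f (x i) = c ↔ f i = c :=
    fun x hx c i => by rw [hx]
  let F : {p : Perm (Fin m) × Perm (Fin m) // p.1 * p.2 = p.2 * p.1 ∧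
      (∀ i, f (p.1 i) = f i) ∧ ∀ i, f (p.2 i) = f i} →
      ∀ c : S, {p : Perm {i // f i = c} × Perm {i // f i = c} // p.1 * p.2 = p.2 * p.1} :=
    fun p c => ⟨(p.1.1.subtypePerm (hh _ p.2.2.1 c), p.1.2.subtypePerm (hh _ p.2.2.2 c)), by
      ext i
      simp only [Perm.mul_apply, Perm.subtypePerm_apply]
      have := congrArg (fun g : Perm (Fin m) => g i.1) p.2.1
      simpa using congrArg Fin.val this⟩
  apply Nat.card_le_card_of_injective F
  intro p q hpq
  apply Subtype.ext
  apply Prod.ext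
  · ext i
    have := congrArg (fun g => ((g (f i)).1.1 ⟨i, rfl⟩).1) hpq
    exact congrArg Fin.val this
  · ext i
    have := congrArg (fun g => ((g (f i)).1.2 ⟨i, rfl⟩).1) hpq
    exact congrArg Fin.val this

/-- The singleton tuple. -/
def sing {m : ℕ} (j : Fin m) : Fin 1 → Omega m 1 := fun _ => ⟨{j}, Finset.card_singleton j⟩

lemma sing_surj {m : ℕ} (w : Fin 1 → Omega m 1) : ∃ j, w = sing j := by
  obtain ⟨j, hj⟩ := Finset.card_eq_one.1 (w 0).2
  refine ⟨j, ?_⟩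
  funext i
  rw [Subsingleton.elim i 0]
  exact Subtype.ext hj

lemma prodHom_sing {m : ℕ} (a : Fin 1 → Perm (Fin m)) (j : Fin m) :
    prodHom m 1 1 a (sing j) = sing (a 0 j) := by
  funext i
  rw [prodHom_apply, Subsingleton.elim i 0]
  apply Subtype.ext
  rw [subs_smul_val]
  simp [sing]

lemma baseTriples_one {m : ℕ} (S : Type) [Finite S] :
    baseTriples m 1 1 S ≤ 2 ^ m *
      (orbitCount (Fin 1 → Perm (Fin m)) ((Fin 1 → Omega m 1) → S) *
      Nat.card (Fin 1 → Perm (Fin m))) := by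
  classical
  have := Fintype.ofFinite S
  rw [← burnside_count]
  unfold baseTriples
  have e1 : ∀ (A B : Type) (R : A → B → Prop), Nat.card {p : A × B // R p.1 p.2} =
      Nat.card {p : B × A // R p.2 p.1} := fun A B R => Nat.card_congr
    { toFun := fun p => ⟨(p.1.2, p.1.1), p.2⟩
      invFun := fun p => ⟨(p.1.2, p.1.1), p.2⟩
      left_inv := fun _ => rfl
      right_inv := fun _ => rfl }
  rw [e1 _ _ (fun (p : (Fin 1 → Perm (Fin m)) × (Fin 1 → Perm (Fin m)))
    (f : (Fin 1 → Omega m 1) → S) => p.1 * p.2 = p.2 * p.1 ∧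
    (∀ w, f (prodHom m 1 1 p.1 w) = f w) ∧ (∀ w, f (prodHom m 1 1 p.2 w) = f w)),
    e1 _ _ (fun (p : (Fin 1 → Perm (Fin m)))
    (f : (Fin 1 → Omega m 1) → S) => ∀ w, f (prodHom m 1 1 p w) = f w),
    card_subtype_prod (fun (f : (Fin 1 → Omega m 1) → S)
    (p : (Fin 1 → Perm (Fin m)) × (Fin 1 → Perm (Fin m))) => p.1 * p.2 = p.2 * p.1 ∧
    (∀ w, f (prodHom m 1 1 p.1 w) = f w) ∧ (∀ w, f (prodHom m 1 1 p.2 w) = f w)),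
    card_subtype_prod (fun 
    (f : (Fin 1 → Omega m 1) → S) (p : (Fin 1 → Perm (Fin m))) =>
      ∀ w, f (prodHom m 1 1 p w) = f w), Finset.mul_sum]
  apply Finset.sum_le_sum
  intro f _
  have h1 := young_count (fun j => f (sing j))
  have h2 : Nat.card {g : Perm (Fin m) // (fun j => f (sing j)) ∘ g = fun j => f (sing j)} ≤
      Nat.card {a : Fin 1 → Perm (Fin m) // ∀ w, f (prodHom m 1 1 a w) = f w} := by
    apply Nat.card_le_card_of_injective (fun g => ⟨fun _ => g.1, by
      intro w
      obtain ⟨j, rfl⟩ := sing_surj w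
      rw [prodHom_sing]
      exact congrFun g.2 j⟩)
    intro g g' h
    exact Subtype.ext (congrArg (fun a => a.1 0) h)
  refine le_trans ?_ (h1.trans (Nat.mul_le_mul_left _ h2))
  apply Nat.card_le_card_of_injective (fun p => ⟨(p.1.1 0, p.1.2 0), by
    refine ⟨congrFun p.2.1 0, fun j => ?_, fun j => ?_⟩
    · have := p.2.2.1 (sing j)
      rwa [prodHom_sing] at this
    · have := p.2.2.2 (sing j)
      rwa [prodHom_sing] at this⟩)
  intro p q h
  have h' := congrArg Subtype.val h
  simp only [Prod.mk.injEq] at h'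
  apply Subtype.ext
  apply Prod.ext
  · funext i
    rw [Subsingleton.elim i 0]; exact h'.1
  · funext i
    rw [Subsingleton.elim i 0]; exact h'.2

lemma baseTriples_le {m ℓ t : ℕ} (ht : 1 ≤ t) (hm5 : 5 ≤ m) (hℓ : 1 ≤ ℓ) (hm : 2 * ℓ < m)
    (S : Type) [Finite S] (hS : 2 ≤ Nat.card S) :
    (baseTriples m ℓ t S : ℝ) ≤ 5 ^ (m * t) *
      ((orbitCount (Fin t → Perm (Fin m)) ((Fin t → Omega m ℓ) → S) : ℝ) *
      (Nat.card (Fin t → Perm (Fin m)) : ℝ)) := by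
  by_cases hne : t = 1 ∧ ℓ = 1
  · obtain ⟨rfl, rfl⟩ := hne
    have h := baseTriples_one (m := m) S
    have h' : (baseTriples m 1 1 S : ℝ) ≤ 2 ^ m *
      ((orbitCount (Fin 1 → Perm (Fin m)) ((Fin 1 → Omega m 1) → S) : ℝ) *
      (Nat.card (Fin 1 → Perm (Fin m)) : ℝ)) := by exact_mod_cast h
    refine h'.trans ?_
    rw [mul_one]
    gcongr
    norm_num
  · exact baseTriples_gen ht hm5 hℓ hm hne S hS

end Part5

/-! ### Part 6: the contribution of the elements outside the base group -/

section Part6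

lemma six_pow_le (m : ℕ) (hm : 5 ≤ m) : (m + 1) ^ 6 ≤ 5 ^ 6 * 2 ^ (m - 1) := by
  rcases Nat.lt_or_ge m 8 with h | h
  · interval_cases m <;> norm_num
  · clear hm
    induction m, h using Nat.le_induction with
    | base => norm_num
    | succ k hk ih =>
      have h1 : (k + 1 + 1) ^ 6 ≤ 2 * (k + 1) ^ 6 := by
        obtain ⟨j, rfl⟩ : ∃ j, k = j + 8 := ⟨k - 8, by omega⟩
        ring_nf
        nlinarith [Nat.zero_le (j ^ 2), Nat.zero_le (j ^ 3), Nat.zero_le (j ^ 4),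
          Nat.zero_le (j ^ 5), Nat.zero_le (j ^ 6)]
      have h2 : 2 ^ (k + 1 - 1) = 2 * 2 ^ (k - 1) := by
        rw [← pow_succ']; congr 1; omega
      rw [h2]
      omega

lemma fact_base (m : ℕ) (hm : 5 ≤ m) :
    2 ^ 6 * m.factorial ^ 12 < 5 ^ (12 * m) * 2 ^ (m * (m - 3)) := by
  induction m, hm using Nat.le_induction with
  | base => norm_num [Nat.factorial]
  | succ k hk ih =>
    have h1 := six_pow_le k hk
    have h2 : ((k + 1) ^ 6) ^ 2 ≤ (5 ^ 6 * 2 ^ (k - 1)) ^ 2 := Nat.pow_le_pow_left h1 2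
    have h3 : (k + 1) * (k + 1 - 3) = k * (k - 3) + (k - 1) * 2 := by
      obtain ⟨j, rfl⟩ : ∃ j, k = j + 5 := ⟨k - 5, by omega⟩
      simp only [show j + 5 + 1 - 3 = j + 3 by omega, show j + 5 - 3 = j + 2 by omega,
        show j + 5 - 1 = j + 4 by omega]
      ring
    calc 2 ^ 6 * (k + 1).factorial ^ 12 = (2 ^ 6 * k.factorial ^ 12) * ((k + 1) ^ 6) ^ 2 := by
          rw [Nat.factorial_succ]; ring
      _ < (5 ^ (12 * k) * 2 ^ (k * (k - 3))) * ((k + 1) ^ 6) ^ 2 := by gcongr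
      _ ≤ (5 ^ (12 * k) * 2 ^ (k * (k - 3))) * (5 ^ 6 * 2 ^ (k - 1)) ^ 2 := by gcongr
      _ = 5 ^ (12 * (k + 1)) * 2 ^ ((k + 1) * (k + 1 - 3)) := by
          rw [h3, pow_add 2, pow_mul 2 (k - 1), mul_add, pow_add 5, mul_pow]; ring

lemma fact_half (m : ℕ) (hm : 5 ≤ m) :
    m.factorial ^ 6 ≤ 5 ^ (6 * m) * 2 ^ (m * (m - 3)) := by
  have h := fact_base m hm
  apply le_of_pow_le_pow_left₀ (n := 2) (by norm_num) (by positivity)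
  calc (m.factorial ^ 6) ^ 2 = 1 * m.factorial ^ 12 := by ring
    _ ≤ 2 ^ 6 * m.factorial ^ 12 := by gcongr; norm_num
    _ ≤ 5 ^ (12 * m) * 2 ^ (m * (m - 3)) := h.le
    _ ≤ 5 ^ (12 * m) * 2 ^ ((m * (m - 3)) * 2) := 
      Nat.mul_le_mul_left _ (Nat.pow_le_pow_right (by norm_num)
        (Nat.le_mul_of_pos_right _ (by norm_num)))
    _ = _ := by rw [pow_mul 2]; ring

lemma fact_main (m t : ℕ) (hm : 5 ≤ m) (ht : 2 ≤ t) :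
    (t.factorial * m.factorial ^ t) ^ 6 < (5 ^ (m * t)) ^ 6 * 2 ^ (m ^ (t - 1) * (m - 3)) := by
  induction t, ht using Nat.le_induction with
  | base =>
    have := fact_base m hm
    calc (Nat.factorial 2 * m.factorial ^ 2) ^ 6 = 2 ^ 6 * m.factorial ^ 12 := by
          simp only [Nat.factorial]; ring
      _ < _ := this
      _ = _ := by
        rw [show 2 - 1 = 1 by norm_num, pow_one]; ring
  | succ t ht ih =>
    have h1 := fact_half m hm
    obtain ⟨T, rfl⟩ : ∃ T, t = T + 1 := ⟨t - 1, by omega⟩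
    obtain ⟨M, rfl⟩ : ∃ M, m = M + 5 := ⟨m - 5, by omega⟩
    simp only [Nat.add_sub_cancel, show M + 5 - 3 = M + 2 by omega] at *
    have h2 : (T + 1 + 1) ≤ 2 ^ (5 ^ T) := by
      have := le_five_pow T
      have h3 : 5 ^ T < 2 ^ (5 ^ T) := Nat.lt_pow_self (by norm_num)
      omega
    have h4 : (M + 5) ^ T * (M + 2) + ((M + 5) * (M + 2) + 5 ^ T * 6) ≤
        (M + 5) ^ (T + 1) * (M + 2) := by
      have a1 : 5 ^ T ≤ (M + 5) ^ T := Nat.pow_le_pow_left (by omega) T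
      have a2 : M + 5 ≤ (M + 5) ^ T := Nat.le_self_pow (by omega) _
      rw [pow_succ]
      generalize (M + 5) ^ T = P at *
      calc P * (M + 2) + ((M + 5) * (M + 2) + 5 ^ T * 6) ≤
          P * (M + 2) + (P * (M + 2) + P * 6) := by gcongr
        _ ≤ P * (M + 2) + P * (M + 2) + P * (M + 2) * 3 := by nlinarith [Nat.zero_le (P * M)]
        _ = P * 5 * (M + 2) := by ring
        _ ≤ _ := Nat.mul_le_mul_right _ (Nat.mul_le_mul_left _ (by omega))
    calc ((T + 1 + 1).factorial * (M + 5).factorial ^ (T + 1 + 1)) ^ 6 =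
        ((T + 1).factorial * (M + 5).factorial ^ (T + 1)) ^ 6 *
          ((M + 5).factorial ^ 6 * (T + 1 + 1) ^ 6) := by
          rw [Nat.factorial_succ (T + 1)]; ring
      _ < ((5 ^ ((M + 5) * (T + 1))) ^ 6 * 2 ^ ((M + 5) ^ T * (M + 2))) *
          ((M + 5).factorial ^ 6 * (T + 1 + 1) ^ 6) := by
          apply Nat.mul_lt_mul_of_pos_right ih
          have := Nat.factorial_pos (M + 5)
          positivity
      _ ≤ ((5 ^ ((M + 5) * (T + 1))) ^ 6 * 2 ^ ((M + 5) ^ T * (M + 2))) *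
          ((5 ^ (6 * (M + 5)) * 2 ^ ((M + 5) * (M + 2))) * (2 ^ (5 ^ T)) ^ 6) := by gcongr
      _ = (5 ^ ((M + 5) * (T + 1 + 1))) ^ 6 *
          2 ^ ((M + 5) ^ T * (M + 2) + ((M + 5) * (M + 2) + 5 ^ T * 6)) := by
          rw [pow_add 2, pow_add 2, pow_mul 2 (5 ^ T)]; ring
      _ ≤ _ := by
          gcongr
          norm_num

lemma final_num (m t ℓ k e : ℕ) (hm : 5 ≤ m) (ht : 2 ≤ t) (hC : m ≤ m.choose ℓ) (hk : 2 ≤ k)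
    (he : 2 * e ≤ m.choose ℓ ^ t + m.choose ℓ ^ (t - 1)) :
    ((t.factorial * m.factorial ^ t : ℕ) : ℝ) * (k : ℝ) ^ e <
      5 ^ (m * t) * (k : ℝ) ^ ((2 * ((m.choose ℓ ^ t : ℕ) : ℝ)) / 3) := by
  have h := fact_main m t hm ht
  set C := m.choose ℓ
  have hk0 : (0 : ℝ) < k := by exact_mod_cast (by omega : 0 < k)
  have hexp : m ^ (t - 1) * (m - 3) + 6 * e ≤ 4 * C ^ t := by
    have h1 : m ^ (t - 1) * (m - 3) ≤ C ^ (t - 1) * (C - 3) :=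
      Nat.mul_le_mul (Nat.pow_le_pow_left hC _) (by omega)
    have h2 : C ^ t = C ^ (t - 1) * (C - 3) + 3 * C ^ (t - 1) := by
      obtain ⟨T, rfl⟩ : ∃ T, t = T + 1 := ⟨t - 1, by omega⟩
      obtain ⟨D, hD⟩ : ∃ D, C = D + 3 := ⟨C - 3, by omega⟩
      rw [hD]
      simp only [Nat.add_sub_cancel]
      ring
    omega
  have hr : ((k : ℝ) ^ ((2 * ((C ^ t : ℕ) : ℝ)) / 3)) ^ 6 = (k : ℝ) ^ (4 * C ^ t) := by
    rw [← Real.rpow_natCast, ← Real.rpow_mul hk0.le, ← Real.rpow_natCast]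
    congr 1
    push_cast
    ring
  apply lt_of_pow_lt_pow_left₀ 6 (by positivity)
  rw [mul_pow, mul_pow, hr]
  have h' : ((t.factorial * m.factorial ^ t : ℕ) : ℝ) ^ 6 <
      (5 ^ (m * t)) ^ 6 * 2 ^ (m ^ (t - 1) * (m - 3)) := by exact_mod_cast h
  have hk2 : (2 : ℝ) ≤ k := by exact_mod_cast hk
  calc ((t.factorial * m.factorial ^ t : ℕ) : ℝ) ^ 6 * ((k : ℝ) ^ e) ^ 6 <
      ((5 ^ (m * t)) ^ 6 * 2 ^ (m ^ (t - 1) * (m - 3))) * ((k : ℝ) ^ e) ^ 6 := by gcongr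
    _ ≤ ((5 ^ (m * t)) ^ 6 * (k : ℝ) ^ (m ^ (t - 1) * (m - 3))) * ((k : ℝ) ^ e) ^ 6 := by gcongr
    _ = (5 ^ (m * t)) ^ 6 * (k : ℝ) ^ (m ^ (t - 1) * (m - 3) + 6 * e) := by
      rw [pow_add, mul_comm 6 e, pow_mul _ e 6]; ring
    _ ≤ _ := by
      gcongr
      linarith

/-- The abstract wreath product `Sym m ≀ Sym t` acting on `Ω^t`. -/
def wrHom (m ℓ t : ℕ) :
    SemidirectProduct (Fin t → Perm (Fin m)) (Perm (Fin t)) (permAut (Fin t) (Perm (Fin m))) →*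
      Perm (Fin t → Omega m ℓ) :=
  SemidirectProduct.lift (prodHom m ℓ t) (topHom t (Omega m ℓ)) (by
    intro π
    ext1 a
    show prodHom m ℓ t (a ∘ π.symm) =
      topHom t (Omega m ℓ) π * prodHom m ℓ t a * (topHom t (Omega m ℓ) π)⁻¹
    rw [eq_mul_inv_iff_mul_eq]
    ext1 w
    funext i
    rfl)

lemma largeBaseTop_le (m ℓ t : ℕ) : largeBaseTop m ℓ t ≤ (wrHom m ℓ t).range := by
  unfold largeBaseTop
  apply sup_le
  · rintro _ ⟨c, hc, rfl⟩
    have hc' : ∀ i, ∃ a, subsetsHom m ℓ a = c i := fun i => hc i (Set.mem_univ i)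
    choose a ha using hc'
    refine ⟨SemidirectProduct.inl a, ?_⟩
    rw [wrHom, SemidirectProduct.lift_inl]
    ext1 w
    funext i
    rw [prodHom_apply]
    show _ = c i (w i)
    rw [← ha]
    rfl
  · rintro _ ⟨π, rfl⟩
    exact ⟨SemidirectProduct.inr π, by rw [wrHom, SemidirectProduct.lift_inr]⟩

lemma card_top (m ℓ t : ℕ) (H : Subgroup (Perm (Fin t → Omega m ℓ)))
    (htop : H ≤ largeBaseTop m ℓ t) : Nat.card H ≤ t.factorial * m.factorial ^ t := by
  have h1 : Nat.card H ≤ Nat.card (wrHom m ℓ t).range :=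
    Nat.card_le_card_of_injective _
      (Subgroup.inclusion_injective (htop.trans (largeBaseTop_le m ℓ t)))
  have hfin : Finite (SemidirectProduct (Fin t → Perm (Fin m)) (Perm (Fin t))
      (permAut (Fin t) (Perm (Fin m)))) := Finite.of_equiv _ SemidirectProduct.equivProd.symm
  refine h1.trans ?_
  refine (Nat.card_le_card_of_surjective _ (wrHom m ℓ t).rangeRestrict_surjective).trans ?_
  rw [SemidirectProduct.card, Nat.card_fun, Nat.card_eq_fintype_card, Nat.card_eq_fintype_card,
    Nat.card_eq_fintype_card, Fintype.card_perm, Fintype.card_perm, Fintype.card_fin,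
    Fintype.card_fin, mul_comm]

lemma card_bot {m ℓ t : ℕ} (hm5 : 5 ≤ m) (hℓ : 1 ≤ ℓ) (hm : 2 * ℓ < m)
    (H : Subgroup (Perm (Fin t → Omega m ℓ)))
    (hbot : largeBaseBot m ℓ t ≤ H) : Nat.card (Fin t → Perm (Fin m)) ≤ 2 ^ t * Nat.card H := by
  have : Nontrivial (Fin m) := Fin.nontrivial_iff_two_le.2 (by omega)
  have h1 : Nat.card (Fin t → alternatingGroup (Fin m)) ≤ Nat.card H := by
    apply Nat.card_le_card_of_injective
      (fun a => (⟨prodHom m ℓ t (fun i => (a i).1), by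
        apply hbot
        refine ⟨fun i => subsetsHom m ℓ (a i).1, fun i _ => ⟨(a i).1, (a i).2, rfl⟩, rfl⟩⟩ : H))
    intro a b hab
    have h2 := prodHom_injective hm5 hℓ hm (congrArg Subtype.val hab)
    funext i
    exact Subtype.ext (congrFun h2 i)
  refine le_trans (le_of_eq ?_) (Nat.mul_le_mul_left _ h1)
  rw [Nat.card_fun, Nat.card_fun, Nat.card_eq_fintype_card (α := Fin t), Fintype.card_fin,
    ← mul_pow, Nat.card_eq_fintype_card, Nat.card_eq_fintype_card,
    two_mul_card_alternatingGroup]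

lemma outside_fix {m ℓ t : ℕ} (x : Perm (Fin t → Omega m ℓ)) (hx : x ∈ largeBaseTop m ℓ t)
    (hxo : x ∉ (prodHom m ℓ t).range) :
    2 ≤ t ∧ Nat.card {w // x w = w} ≤ m.choose ℓ ^ (t - 1) := by
  classical
  obtain ⟨⟨a, π⟩, rfl⟩ := largeBaseTop_le m ℓ t hx
  have hap : ∀ w i, wrHom m ℓ t ⟨a, π⟩ w i = a i • w (π⁻¹ i) := fun w i => rfl
  have hπ : ∃ i, π⁻¹ i ≠ i := by
    by_contra h
    push Not at h
    apply hxo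
    refine ⟨a, ?_⟩
    ext1 w
    funext i
    rw [hap, h, prodHom_apply]
  obtain ⟨i, hi⟩ := hπ
  constructor
  · by_contra h
    have : Subsingleton (Fin t) := Fin.subsingleton_iff_le_one.2 (by omega)
    exact hi (Subsingleton.elim _ _)
  · have hc : Nat.card ({j : Fin t // j ≠ i} → Omega m ℓ) = m.choose ℓ ^ (t - 1) := by
      rw [Nat.card_fun, Nat.card_eq_fintype_card, Nat.card_eq_fintype_card, card_Omega,
        Fintype.card_subtype_compl, Fintype.card_fin, Fintype.card_subtype_eq]
    rw [← hc]
    apply Nat.card_le_card_of_injective (fun w j => w.1 j.1)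
    rintro ⟨w, hw⟩ ⟨w', hw'⟩ h
    apply Subtype.ext
    have hj : ∀ j, j ≠ i → w j = w' j := fun j hj => congrFun h ⟨j, hj⟩
    funext j
    by_cases hji : j = i
    · subst hji
      have e1 := hap w j
      have e2 := hap w' j
      rw [hw] at e1
      rw [hw'] at e2
      show w j = w' j
      rw [e1, e2, hj _ hi]
    · exact hj j hji

lemma triples_le {m ℓ t : ℕ} (hm5 : 5 ≤ m) (hℓ : 1 ≤ ℓ) (hm : 2 * ℓ < m)
    (H : Subgroup (Perm (Fin t → Omega m ℓ))) (htop : H ≤ largeBaseTop m ℓ t)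
    (S : Type) [Finite S] (hS : 2 ≤ Nat.card S) :
    Nat.card (Triples H S) ≤ baseTriples m ℓ t S + (if 2 ≤ t then
      Nat.card H * Nat.card H * Nat.card S ^ ((m.choose ℓ ^ t + m.choose ℓ ^ (t - 1)) / 2)
      else 0) := by
  classical
  have hfin : Finite (Triples H S) := by unfold Triples; infer_instance
  let R := (prodHom m ℓ t).range
  let P : Triples H S → Prop := fun z => z.1.1.1.1 ∈ R ∧ z.1.1.2.1 ∈ R
  have hinj := prodHom_injective (t := t) hm5 hℓ hm
  rw [← Nat.card_congr (Equiv.sumCompl P), Nat.card_sum]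
  apply Nat.add_le_add
  · unfold baseTriples
    let F : {z // P z} → {p : ((Fin t → Perm (Fin m)) × (Fin t → Perm (Fin m))) ×
        ((Fin t → Omega m ℓ) → S) //
        p.1.1 * p.1.2 = p.1.2 * p.1.1 ∧ (∀ w, p.2 (prodHom m ℓ t p.1.1 w) = p.2 w) ∧
        (∀ w, p.2 (prodHom m ℓ t p.1.2 w) = p.2 w)} := fun z =>
      ⟨((z.2.1.choose, z.2.2.choose), z.1.1.2), by
        have h1 := z.2.1.choose_spec
        have h2 := z.2.2.choose_spec
        have h3 := z.1.2
        refine ⟨?_, ?_, ?_⟩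
        · apply hinj
          rw [map_mul, map_mul, h1, h2]
          exact congrArg Subtype.val h3.1
        · rw [h1]; exact h3.2.1
        · rw [h2]; exact h3.2.2⟩
    apply Nat.card_le_card_of_injective F
    intro z z' h
    have h' := congrArg Subtype.val h
    simp only [F, Prod.mk.injEq] at h'
    obtain ⟨⟨h1, h2⟩, h3⟩ := h'
    have a1 := z.2.1.choose_spec
    have a2 := z.2.2.choose_spec
    have b1 := z'.2.1.choose_spec
    have b2 := z'.2.2.choose_spec
    rw [h1, b1] at a1
    rw [h2, b2] at a2
    apply Subtype.ext
    apply Subtype.ext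
    exact Prod.ext (Prod.ext (Subtype.ext a1.symm) (Subtype.ext a2.symm)) h3
  · have : Fintype H := Fintype.ofFinite H
    set B := (if 2 ≤ t then
      Nat.card S ^ ((m.choose ℓ ^ t + m.choose ℓ ^ (t - 1)) / 2) else 0) with hB
    have hB' : (if 2 ≤ t then
      Nat.card H * Nat.card H * Nat.card S ^ ((m.choose ℓ ^ t + m.choose ℓ ^ (t - 1)) / 2)
      else 0) = Nat.card H * Nat.card H * B := by
      rw [hB]; split_ifs <;> simp
    rw [hB']
    let Q : H × H → ((Fin t → Omega m ℓ) → S) → Prop := fun p f =>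
      ¬ (p.1.1 ∈ R ∧ p.2.1 ∈ R) ∧ (∀ w, f (p.1.1 w) = f w) ∧ (∀ w, f (p.2.1 w) = f w)
    have h1 : Nat.card {z // ¬ P z} ≤ Nat.card {p : (H × H) × ((Fin t → Omega m ℓ) → S) //
        Q p.1 p.2} := by
      apply Nat.card_le_card_of_injective (fun z => ⟨z.1.1, z.2, z.1.2.2⟩)
      intro z z' h
      have h' := congrArg Subtype.val h
      exact Subtype.ext (Subtype.ext h')
    refine h1.trans ?_
    rw [card_subtype_prod Q]
    calc ∑ p, Nat.card {f // Q p f} ≤ ∑ p : H × H, B := by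
          apply Finset.sum_le_sum
          rintro ⟨x, y⟩ _
          by_cases hin : x.1 ∈ R ∧ y.1 ∈ R
          · have : IsEmpty {f // Q (x, y) f} := ⟨fun f => f.2.1 hin⟩
            simp
          · have hfix : 2 ≤ t ∧ Nat.card {w // x.1 w = w ∧ y.1 w = w} ≤ m.choose ℓ ^ (t - 1) := by
              rw [not_and_or] at hin
              rcases hin with hin | hin
              · obtain ⟨h2, h3⟩ := outside_fix x.1 (htop x.2) hin
                refine ⟨h2, le_trans ?_ h3⟩
                apply Nat.card_le_card_of_injective (fun w => ⟨w.1, w.2.1⟩)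
                intro w w' h
                have h' := congrArg Subtype.val h
                exact Subtype.ext h'
              · obtain ⟨h2, h3⟩ := outside_fix y.1 (htop y.2) hin
                refine ⟨h2, le_trans ?_ h3⟩
                apply Nat.card_le_card_of_injective (fun w => ⟨w.1, w.2.2⟩)
                intro w w' h
                have h' := congrArg Subtype.val h
                exact Subtype.ext h'
            obtain ⟨ht, hfix⟩ := hfix
            rw [hB, if_pos ht]
            obtain ⟨o, ho, ho2⟩ := inv_count (S := S) x.1 y.1
            have hn : Nat.card (Fin t → Omega m ℓ) = m.choose ℓ ^ t := by
              rw [Nat.card_fun, Nat.card_eq_fintype_card (α := Omega m ℓ), card_Omega,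
                Nat.card_eq_fintype_card (α := Fin t), Fintype.card_fin]
            rw [hn] at ho2
            have h4 : Nat.card {f // Q (x, y) f} ≤ Nat.card S ^ o := by
              rw [← ho]
              apply Nat.card_le_card_of_injective (fun f => ⟨f.1, f.2.2⟩)
              intro w w' h
              have h' := congrArg Subtype.val h
              exact Subtype.ext h'
            refine h4.trans (Nat.pow_le_pow_right (by omega) ?_)
            omega
      _ = _ := by
          rw [Finset.sum_const, Finset.card_univ, Fintype.card_prod, smul_eq_mul,
            Nat.card_eq_fintype_card]

end Part6

lemma two_le_kclass (X : Type) [Group X] [Finite X] [Nontrivial X] : 2 ≤ kclass X := by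
  have : Nontrivial (ConjClasses X) := by
    obtain ⟨x, hx⟩ := exists_ne (1 : X)
    refine ⟨ConjClasses.mk x, ConjClasses.mk 1, fun h => hx ?_⟩
    rw [ConjClasses.mk_eq_mk_iff_isConj] at h
    exact isConj_one_left.1 h
  have := Finite.one_lt_card (α := ConjClasses X)
  exact this

/-- For a large base primitive group `H` of degree `n = C(m,ℓ)^t`, the class number of
`G = X ≀ H` satisfies `k(G) < 5^{mt} (2^t n((Sym m)^t, S^{Ω^t}) + k^{2n/3})`. -/
theorem statement15 (X : Type) [Group X] [Finite X] [Nontrivial X]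
    (t m ℓ : ℕ) (ht : 1 ≤ t) (hm : 5 ≤ m) (hℓ1 : 1 ≤ ℓ) (hℓm : 2 * ℓ < m)
    (n : ℕ) (hn : n = (m.choose ℓ) ^ t)
    (H : Subgroup (Perm (Fin t → Omega m ℓ)))
    (hbot : largeBaseBot m ℓ t ≤ H) (htop : H ≤ largeBaseTop m ℓ t)
    (hprim : IsPretransitive H (Fin t → Omega m ℓ) ∧
      ∀ B : Set (Fin t → Omega m ℓ), IsBlock H B → B.Subsingleton ∨ B = Set.univ)
    (S : Type) [Finite S] (hS : Nat.card S = kclass X) :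
    (kclass (Wreath X H) : ℝ) <
      5 ^ (m * t) *
        (2 ^ t * (orbitCount (Fin t → Perm (Fin m)) ((Fin t → Omega m ℓ) → S) : ℝ) +
          (kclass X : ℝ) ^ ((2 * (n : ℝ)) / 3)) := by
  have hk2 : 2 ≤ Nat.card S := by rw [hS]; exact two_le_kclass X
  have h1 := kclass_wreath_le (X := X) H
  have e : ConjClasses X ≃ S := Nonempty.some (by
    rw [← Finite.card_eq]; exact hS.symm)
  have h2 : Nat.card (Triples H (ConjClasses X)) ≤ Nat.card (Triples H S) := by
    have hfin : Finite (Triples H S) := by unfold Triples; infer_instance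
    apply Nat.card_le_card_of_injective (fun z : Triples H (ConjClasses X) =>
      (⟨(z.1.1, fun i => e (z.1.2 i)), z.2.1, fun i => congrArg e (z.2.2.1 i),
        fun i => congrArg e (z.2.2.2 i)⟩ : Triples H S))
    intro z z' h
    have h' := congrArg Subtype.val h
    simp only [Prod.mk.injEq] at h'
    exact Subtype.ext (Prod.ext h'.1 (funext fun i => e.injective (congrFun h'.2 i)))
  have h3 := triples_le hm hℓ1 hℓm H htop S hk2
  have h4 := baseTriples_le ht hm hℓ1 hℓm S hk2
  have h5 := card_bot hm hℓ1 hℓm H hbot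
  have h6 := card_top m ℓ t H htop
  have hHpos : 0 < Nat.card H := Nat.card_pos
  rw [← hS, hn]
  set N : ℝ := (orbitCount (Fin t → Perm (Fin m)) ((Fin t → Omega m ℓ) → S) : ℝ)
  set q := Nat.card S
  set E := (m.choose ℓ ^ t + m.choose ℓ ^ (t - 1)) / 2
  have hN0 : 0 ≤ N := Nat.cast_nonneg _
  have hq0 : (0 : ℝ) < q := by exact_mod_cast (by omega : 0 < q)
  have hH : (0 : ℝ) < Nat.card H := by exact_mod_cast hHpos
  have h7 : (kclass (Wreath X H) : ℝ) * Nat.card H ≤ baseTriples m ℓ t S +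
      (if 2 ≤ t then (Nat.card H : ℝ) * Nat.card H * (q : ℝ) ^ E else 0) := by
    have := h1.trans (h2.trans h3)
    split_ifs at this ⊢
    · exact_mod_cast this
    · exact_mod_cast this
  have h8 : (if 2 ≤ t then (Nat.card H : ℝ) * Nat.card H * (q : ℝ) ^ E else 0) <
      (5 ^ (m * t) * (q : ℝ) ^ ((2 * ((m.choose ℓ ^ t : ℕ) : ℝ)) / 3)) * Nat.card H := by
    split_ifs with h
    · have h9 := final_num m t ℓ q E hm h (le_choose_self hℓ1 hℓm) hk2 (by omega)
      have h10 : (Nat.card H : ℝ) ≤ ((t.factorial * m.factorial ^ t : ℕ) : ℝ) := by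
        exact_mod_cast h6
      calc (Nat.card H : ℝ) * Nat.card H * (q : ℝ) ^ E =
          ((Nat.card H : ℝ) * (q : ℝ) ^ E) * Nat.card H := by ring
        _ ≤ (((t.factorial * m.factorial ^ t : ℕ) : ℝ) * (q : ℝ) ^ E) * Nat.card H := by gcongr
        _ < _ := by gcongr
    · positivity
  have h5' : (Nat.card (Fin t → Perm (Fin m)) : ℝ) ≤ 2 ^ t * Nat.card H := by exact_mod_cast h5
  have h11 : (baseTriples m ℓ t S : ℝ) ≤ (5 ^ (m * t) * (2 ^ t * N)) * Nat.card H := by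
    refine h4.trans ?_
    calc 5 ^ (m * t) * (N * (Nat.card (Fin t → Perm (Fin m)) : ℝ)) ≤
        5 ^ (m * t) * (N * (2 ^ t * Nat.card H)) := by gcongr
      _ = _ := by ring
  refine lt_of_mul_lt_mul_right ?_ hH.le
  rw [mul_add, add_mul]
  linarith
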